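/- Let (W,S) be a Coxeter system with root system Φ, let w ∈ W and let α ∈ Φ be a root that is not w-periodic. Then the set {m ∈ ℤ : α separates w^m and w^{m+1}} is finite. Consequently, every root α ∈ Φ satisfies exactly one of: α is w-periodic; α is not w-periodic and the above set has even cardinality (α is w-even); α is not w-periodic and the above set has odd cardinality (α is w-odd). -/

import Mathlib

/-!
Statement 0: Let (W,S) be a Coxeter system with root system Φ, let w ∈ W and let α ∈ Φ be a
root that is not w-periodic. Then the set {m ∈ ℤ : α separates w^m and w^{m+1}} is finite.
Consequently, every root α ∈ Φ satisfies exactly one of: α is w-periodic; α is not w-periodic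
and the above set has even cardinality (α is w-even); α is not w-periodic and the above set has
odd cardinality (α is w-odd).
-/

noncomputable section

namespace CoxeterPaper

variable {B : Type*}

/-- The entry `⟨α_s, α_t⟩` of the canonical bilinear form: `-cos (π / m_{s,t})` if
`m_{s,t} < ∞`, and `-1` if `m_{s,t} = ∞` (encoded by `M s t = 0`). -/
noncomputable def formEntry (M : CoxeterMatrix B) (s t : B) : ℝ :=
  if M s t = 0 then -1 else -Real.cos (Real.pi / (M s t : ℝ))

/-- The canonical bilinear form on `V = ⊕_{s ∈ S} ℝ α_s`, identified with `B → ℝ` via the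
basis of simple roots. -/
noncomputable def canonicalForm [Fintype B] (M : CoxeterMatrix B) (x y : B → ℝ) : ℝ :=
  ∑ s, ∑ t, x s * y t * formEntry M s t

/-- The simple root `α_s`, i.e. the `s`-th standard basis vector of `B → ℝ`. -/
def simpleRoot [DecidableEq B] (s : B) : B → ℝ := Pi.single s 1

variable [Fintype B] [DecidableEq B] {W : Type*} [Group W] {M : CoxeterMatrix B}

/-- `v` belongs to the root system `Φ = {w α_s : w ∈ W, s ∈ S}` (with respect to the
canonical representation `ρ`). -/
def IsRoot (ρ : W →* ((B → ℝ) ≃ₗ[ℝ] (B → ℝ))) (v : B → ℝ) : Prop :=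
  ∃ (w : W) (s : B), v = ρ w (simpleRoot s)

/-- `v` is positive: all its coordinates in the basis of simple roots are nonnegative. -/
def IsPos (v : B → ℝ) : Prop := ∀ t, 0 ≤ v t

/-- `v` is negative: `-v` is positive. -/
def IsNeg (v : B → ℝ) : Prop := IsPos (-v)

/-- The root `α` separates `u` and `v`: there is `ε ∈ {±1}` with `u α ∈ Φ^ε` and
`v α ∈ Φ^{-ε}`. -/
def Separates (ρ : W →* ((B → ℝ) ≃ₗ[ℝ] (B → ℝ))) (α : B → ℝ) (u v : W) : Prop :=
  (IsPos (ρ u α) ∧ IsNeg (ρ v α)) ∨ (IsNeg (ρ u α) ∧ IsPos (ρ v α))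

/-- The set `{m ∈ ℤ : α separates w^m and w^{m+1}}`. -/
def sepSet (ρ : W →* ((B → ℝ) ≃ₗ[ℝ] (B → ℝ))) (w : W) (α : B → ℝ) : Set ℤ :=
  {m : ℤ | Separates ρ α (w ^ m) (w ^ (m + 1))}

/-- `α` is `w`-periodic: `w^m α = α` for some `m ≥ 1`. -/
def IsPeriodic (ρ : W →* ((B → ℝ) ≃ₗ[ℝ] (B → ℝ))) (w : W) (α : B → ℝ) : Prop :=
  ∃ m : ℕ, 1 ≤ m ∧ ρ (w ^ m) α = α

/-- `α` is `w`-even: not `w`-periodic, and the set `{m ∈ ℤ : α separates w^m and w^{m+1}}`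
is finite of even cardinality. -/
def IsWEven (ρ : W →* ((B → ℝ) ≃ₗ[ℝ] (B → ℝ))) (w : W) (α : B → ℝ) : Prop :=
  ¬ IsPeriodic ρ w α ∧ (sepSet ρ w α).Finite ∧ Even (sepSet ρ w α).ncard

/-- `α` is `w`-odd: not `w`-periodic, and the set `{m ∈ ℤ : α separates w^m and w^{m+1}}`
is finite of odd cardinality. -/
def IsWOdd (ρ : W →* ((B → ℝ) ≃ₗ[ℝ] (B → ℝ))) (w : W) (α : B → ℝ) : Prop :=
  ¬ IsPeriodic ρ w α ∧ (sepSet ρ w α).Finite ∧ Odd (sepSet ρ w α).ncard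

/-- The canonical form is the bilinear form of the matrix with entries `formEntry`. -/
theorem canonicalForm_eq_toBilin' (M : CoxeterMatrix B) (x y : B → ℝ) :
    canonicalForm M x y = Matrix.toBilin' (Matrix.of (formEntry M)) x y := by
  simp only [canonicalForm, Matrix.toBilin'_apply, Matrix.of_apply]
  exact Finset.sum_congr rfl fun _ _ => Finset.sum_congr rfl fun _ _ => by ring

omit [Fintype B] [DecidableEq B] in
theorem formEntry_comm (M : CoxeterMatrix B) (s t : B) : formEntry M s t = formEntry M t s := by
  simp only [formEntry, M.symmetric s t]

omit [Fintype B] [DecidableEq B] in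
theorem formEntry_self (M : CoxeterMatrix B) (s : B) : formEntry M s s = 1 := by
  simp [formEntry]

omit [DecidableEq B] in
theorem canonicalForm_comm (M : CoxeterMatrix B) (x y : B → ℝ) :
    canonicalForm M x y = canonicalForm M y x := by
  unfold canonicalForm
  rw [Finset.sum_comm]
  refine Finset.sum_congr rfl fun s _ => Finset.sum_congr rfl fun t _ => ?_
  rw [formEntry_comm M t s]
  ring

theorem canonicalForm_simpleRoot (M : CoxeterMatrix B) (s t : B) :
    canonicalForm M (simpleRoot s) (simpleRoot t) = formEntry M s t := by
  rw [canonicalForm_eq_toBilin', simpleRoot, simpleRoot, Matrix.toBilin'_single, Matrix.of_apply]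

theorem canonicalForm_reflection (M : CoxeterMatrix B) (s : B) (x : B → ℝ) :
    canonicalForm M (x - (2 * canonicalForm M x (simpleRoot s)) • simpleRoot s)
      (x - (2 * canonicalForm M x (simpleRoot s)) • simpleRoot s) = canonicalForm M x x := by
  have h₁ := canonicalForm_comm M (simpleRoot s) x
  have h₂ := (canonicalForm_simpleRoot M s s).trans (formEntry_self M s)
  generalize canonicalForm M x (simpleRoot s) = c at *
  have h₃ : canonicalForm M x (simpleRoot s) = c := by rw [canonicalForm_comm, h₁]
  rw [canonicalForm_eq_toBilin'] at h₁ h₂ h₃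
  rw [canonicalForm_eq_toBilin', canonicalForm_eq_toBilin']
  simp only [map_sub, map_smul, LinearMap.sub_apply, LinearMap.smul_apply, h₁, h₂, h₃, smul_eq_mul]
  ring

omit [Fintype B] [DecidableEq B] in
/-- The coefficients occurring in the dihedral orbits of a pair of simple roots: the solution of
`p (k + 2) = -2 ⟨α_s, α_t⟩ p (k + 1) - p k` is nonnegative up to the order of `st`. -/
theorem exists_dihedral_coeff (M : CoxeterMatrix B) {s t : B} (hst : s ≠ t) :
    ∃ p : ℕ → ℝ, p 0 = 0 ∧ p 1 = 1 ∧
      (∀ k, p (k + 2) = -2 * formEntry M s t * p (k + 1) - p k) ∧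
      ∀ k, M s t = 0 ∨ k ≤ M s t → 0 ≤ p k := by
  by_cases hm : M s t = 0
  · refine ⟨fun k => k, by simp, by simp, fun k => ?_, fun k _ => k.cast_nonneg⟩
    simp only [formEntry, hm, if_true]
    push_cast
    ring
  · have hm1 : M s t ≠ 1 := M.off_diagonal s t hst
    have hm2 : (2 : ℝ) ≤ M s t := by exact_mod_cast (by omega : 2 ≤ M s t)
    set θ : ℝ := Real.pi / M s t with hθ
    have hθ0 : 0 < θ := by positivity
    have hθm : M s t * θ = Real.pi := by rw [hθ]; field_simp
    have hθπ : θ < Real.pi := by nlinarith [Real.pi_pos]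
    have hsin : 0 < Real.sin θ := Real.sin_pos_of_pos_of_lt_pi hθ0 hθπ
    refine ⟨fun k => Real.sin (k * θ) / Real.sin θ, by simp, by simp [hsin.ne'], fun k => ?_,
      fun k hk => ?_⟩
    · simp only [formEntry, hm, if_false, ← hθ]
      have h₁ : ((k + 2 : ℕ) : ℝ) * θ = ((k + 1 : ℕ) : ℝ) * θ + θ := by push_cast; ring
      have h₂ : (k : ℝ) * θ = ((k + 1 : ℕ) : ℝ) * θ - θ := by push_cast; ring
      rw [h₁, h₂, Real.sin_add, Real.sin_sub]
      ring
    · refine div_nonneg (Real.sin_nonneg_of_nonneg_of_le_pi (by positivity) ?_) hsin.le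
      rw [← hθm]
      have : (k : ℝ) ≤ M s t := by exact_mod_cast hk.resolve_left hm
      gcongr

open CoxeterSystem

section Length

omit [Fintype B] [DecidableEq B]

/-- An element `w` with right descent `t` factors reducedly as `v` times an alternating word in
`s, t` ending in `t`, where neither `s` nor `t` is a right descent of `v`. If `s` is not a right
descent of `w`, the alternating word is shorter than the order of `st`. -/
theorem exists_dihedral_decomposition (cs : CoxeterSystem M W) {w : W} {s t : B}
    (hs : cs.length w < cs.length (w * cs.simple s))
    (ht : cs.length (w * cs.simple t) < cs.length w) :
    ∃ (v : W) (k : ℕ), w = v * cs.wordProd (alternatingWord s t k) ∧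
      cs.length v < cs.length w ∧
      cs.length v < cs.length (v * cs.simple s) ∧ cs.length v < cs.length (v * cs.simple t) ∧
      (M s t = 0 ∨ k < M s t) := by
  let D : ℕ → Prop := fun k =>
    cs.length (w * (cs.wordProd (alternatingWord s t k))⁻¹) + k = cs.length w
  have hstep : ∀ k, w * (cs.wordProd (alternatingWord s t (k + 1)))⁻¹ =
      w * (cs.wordProd (alternatingWord s t k))⁻¹ * cs.simple (if Even k then t else s) := by
    intro k
    rw [alternatingWord_succ', wordProd_cons, mul_inv_rev, inv_simple, mul_assoc]
  have hstep' : ∀ k, w * (cs.wordProd (alternatingWord s t k))⁻¹ =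
      w * (cs.wordProd (alternatingWord s t (k + 1)))⁻¹ *
        cs.simple (if Even k then t else s) := by
    intro k
    rw [hstep, simple_mul_simple_cancel_right]
  have hle : ∀ k, cs.length w ≤ cs.length (w * (cs.wordProd (alternatingWord s t k))⁻¹) + k := by
    intro k
    have h₁ := cs.length_le_length_mul_add_right w (cs.wordProd (alternatingWord s t k))⁻¹
    have h₂ := cs.length_wordProd_le (alternatingWord s t k)
    rw [length_inv] at h₁
    rw [length_alternatingWord] at h₂
    omega
  have hanti : Antitone D := antitone_nat_of_succ_le fun k (hk : _ + _ = _) => by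
    have h₁ := hle k
    have h₂ := cs.length_mul_simple (w * (cs.wordProd (alternatingWord s t (k + 1)))⁻¹)
      (if Even k then t else s)
    rw [← hstep'] at h₂
    change _ + _ = _
    omega
  have h₀ : D 0 := by simp [D, alternatingWord]
  have h₁ : D 1 := by
    have := cs.length_mul_simple w t
    simp only [D, alternatingWord, List.concat_eq_append, List.nil_append, wordProd_singleton,
      inv_simple]
    omega
  obtain ⟨k, hk, hk'⟩ : ∃ k, D k ∧ ¬ D (k + 1) := by
    by_contra! h
    have hall : ∀ k, D k := fun k => Nat.rec h₀ h k
    have : _ + _ = _ := hall (cs.length w + 1)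
    omega
  have hM : M s t = 0 ∨ k < M s t := by
    by_contra! hkM
    have hD : _ + _ = _ := hanti hkM.2 hk
    obtain ⟨m, hm⟩ := Nat.exists_eq_succ_of_ne_zero hkM.1
    have hbraid := cs.wordProd_braidWord_eq s t
    rw [braidWord, braidWord, M.symmetric t s, hm, Nat.succ_eq_add_one,
      alternatingWord_succ t s, wordProd_concat] at hbraid
    rw [hm, Nat.succ_eq_add_one] at hD
    have hw : w * cs.simple s = w * (cs.wordProd (alternatingWord s t (m + 1)))⁻¹ *
        cs.wordProd (alternatingWord s t m) := by
      rw [hbraid]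
      simp [mul_assoc]
    have h₂ := cs.length_mul_le (w * (cs.wordProd (alternatingWord s t (m + 1)))⁻¹)
      (cs.wordProd (alternatingWord s t m))
    have h₃ := cs.length_wordProd_le (alternatingWord s t m)
    rw [← hw] at h₂
    rw [length_alternatingWord] at h₃
    omega
  obtain ⟨j, rfl⟩ : ∃ j, k = j + 1 := by
    refine Nat.exists_eq_succ_of_ne_zero ?_
    rintro rfl
    exact hk' h₁
  have hj : D j := hanti (Nat.le_succ j) hk
  have hup₁ : cs.length (w * (cs.wordProd (alternatingWord s t (j + 1)))⁻¹) <
      cs.length (w * (cs.wordProd (alternatingWord s t (j + 1)))⁻¹ *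
        cs.simple (if Even j then t else s)) := by
    rw [← hstep']
    change _ + _ = _ at hk
    change _ + _ = _ at hj
    omega
  have hup₂ : cs.length (w * (cs.wordProd (alternatingWord s t (j + 1)))⁻¹) <
      cs.length (w * (cs.wordProd (alternatingWord s t (j + 1)))⁻¹ *
        cs.simple (if Even (j + 1) then t else s)) := by
    have h₂ := cs.length_mul_simple (w * (cs.wordProd (alternatingWord s t (j + 1)))⁻¹)
      (if Even (j + 1) then t else s)
    rw [← hstep] at h₂ ⊢
    change _ + _ = _ at hk
    change ¬ (_ + _ = _) at hk'
    omega
  refine ⟨w * (cs.wordProd (alternatingWord s t (j + 1)))⁻¹, j + 1, by simp, ?_, ?_, ?_, hM⟩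
  · change _ + _ = _ at hk
    omega
  · by_cases hj2 : Even j
    · simpa [Nat.even_add_one, hj2] using hup₂
    · simpa [hj2] using hup₁
  · by_cases hj2 : Even j
    · simpa [hj2] using hup₁
    · simpa [Nat.even_add_one, hj2] using hup₂

end Length

section Representation

variable {cs : CoxeterSystem M W} {ρ : W →* ((B → ℝ) ≃ₗ[ℝ] (B → ℝ))}
  (hρ : ∀ (s : B) (x : B → ℝ), ρ (cs.simple s) x =
    x - (2 * canonicalForm M x (simpleRoot s)) • simpleRoot s)

omit [Fintype B] [DecidableEq B] in
theorem rep_mul_apply (u v : W) (x : B → ℝ) : ρ (u * v) x = ρ u (ρ v x) := by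
  rw [map_mul, LinearEquiv.mul_apply]

include hρ

theorem simple_simpleRoot (s t : B) : ρ (cs.simple s) (simpleRoot t) =
    simpleRoot t - (2 * formEntry M t s) • simpleRoot s := by
  rw [hρ, canonicalForm_simpleRoot]

theorem simple_simpleRoot_self (s : B) : ρ (cs.simple s) (simpleRoot s) = -simpleRoot s := by
  rw [simple_simpleRoot hρ, formEntry_self]
  module

theorem canonicalForm_rep (w : W) (x : B → ℝ) :
    canonicalForm M (ρ w x) (ρ w x) = canonicalForm M x x := by
  induction w using cs.simple_induction_left with
  | one => simp
  | mul_simple_left w s ih => rw [rep_mul_apply, hρ s, canonicalForm_reflection, ih]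

theorem canonicalForm_root {β : B → ℝ} (hβ : IsRoot ρ β) : canonicalForm M β β = 1 := by
  obtain ⟨w, s, rfl⟩ := hβ
  rw [canonicalForm_rep hρ, canonicalForm_simpleRoot, formEntry_self]

theorem alternatingWord_simpleRoot {s t : B} {p : ℕ → ℝ} (h₀ : p 0 = 0) (h₁ : p 1 = 1)
    (hp : ∀ k, p (k + 2) = -2 * formEntry M s t * p (k + 1) - p k) (k : ℕ) :
    ρ (cs.wordProd (alternatingWord s t k)) (simpleRoot s) =
      (if Even k then p (k + 1) else p k) • simpleRoot s +
      (if Even k then p k else p (k + 1)) • simpleRoot t := by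
  induction k with
  | zero => simp [alternatingWord, h₀, h₁]
  | succ k ih =>
    rw [alternatingWord_succ', wordProd_cons, rep_mul_apply, ih, map_add, map_smul, map_smul]
    by_cases hk : Even k
    · simp only [hk, if_true, Nat.even_add_one, not_true, if_false, simple_simpleRoot_self hρ,
        simple_simpleRoot hρ t s, hp]
      module
    · simp only [hk, if_false, Nat.even_add_one, not_false_eq_true, if_true,
        simple_simpleRoot_self hρ, simple_simpleRoot hρ s t, hp, formEntry_comm M t s]
      module

/-- If `ℓ(ws) > ℓ(w)` then `w α_s` is positive. -/
theorem isPos_of_length_lt (w : W) (s : B) (h : cs.length w < cs.length (w * cs.simple s)) :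
    IsPos (ρ w (simpleRoot s)) := by
  induction hn : cs.length w using Nat.strong_induction_on generalizing w s with
  | _ n ih =>
    subst hn
    by_cases hw : w = 1
    · subst hw
      intro t
      by_cases hts : t = s <;> simp [simpleRoot, hts]
    obtain ⟨t, ht⟩ := cs.exists_rightDescent_of_ne_one hw
    have hst : s ≠ t := by
      rintro rfl
      exact lt_asymm h ht
    obtain ⟨v, k, hvk, hv, hvs, hvt, hk⟩ := exists_dihedral_decomposition cs h ht
    obtain ⟨p, h₀, h₁, hp, hpos⟩ := exists_dihedral_coeff M hst
    have hpk : 0 ≤ p k := hpos k (hk.imp_right le_of_lt)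
    have hpk' : 0 ≤ p (k + 1) := hpos (k + 1) (hk.imp_right Nat.succ_le_of_lt)
    have hvs_pos := ih _ hv v s hvs rfl
    have hvt_pos := ih _ hv v t hvt rfl
    rw [hvk, rep_mul_apply, alternatingWord_simpleRoot hρ h₀ h₁ hp, map_add, map_smul, map_smul]
    intro r
    simp only [Pi.add_apply, Pi.smul_apply, smul_eq_mul]
    exact add_nonneg (mul_nonneg (by split_ifs <;> assumption) (hvs_pos r))
      (mul_nonneg (by split_ifs <;> assumption) (hvt_pos r))

/-- Every root is positive or negative. -/
theorem isPos_or_isNeg_of_isRoot {β : B → ℝ} (hβ : IsRoot ρ β) : IsPos β ∨ IsNeg β := by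
  obtain ⟨w, s, rfl⟩ := hβ
  rcases cs.length_mul_simple w s with h | h
  · exact Or.inl (isPos_of_length_lt hρ w s (by omega))
  · right
    have := isPos_of_length_lt hρ (w * cs.simple s) s
      (by rw [simple_mul_simple_cancel_right]; omega)
    rwa [rep_mul_apply, simple_simpleRoot_self hρ, map_neg] at this

/-- The only positive root made negative by a simple reflection is its simple root. -/
theorem eq_simpleRoot_of_isPos_of_isNeg {β : B → ℝ} (hβ : IsRoot ρ β) {s : B} (hpos : IsPos β)
    (hneg : IsNeg (ρ (cs.simple s) β)) : β = simpleRoot s := by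
  have hsupp : β = β s • simpleRoot s := by
    funext t
    by_cases hts : t = s
    · subst hts
      simp [simpleRoot]
    · have h₁ := hpos t
      have h₂ := hneg t
      rw [hρ] at h₂
      simp only [Pi.neg_apply, Pi.sub_apply, Pi.smul_apply, simpleRoot, Pi.single_apply, hts,
        if_false, smul_zero, sub_zero] at h₂
      simp only [Pi.smul_apply, simpleRoot, Pi.single_apply, hts, if_false, smul_zero]
      linarith
  have hnorm := canonicalForm_root hρ hβ
  have hself := (canonicalForm_simpleRoot M s s).trans (formEntry_self M s)
  rw [canonicalForm_eq_toBilin'] at hself hnorm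
  rw [hsupp] at hnorm
  simp only [map_smul, LinearMap.smul_apply, hself, smul_eq_mul, mul_one] at hnorm
  have hβs : β s = 1 := by nlinarith [hpos s]
  rw [hsupp, hβs, one_smul]

/-- The inversion set of an element of `W` is finite. -/
theorem finite_inversions (w : W) :
    {β : B → ℝ | IsRoot ρ β ∧ IsPos β ∧ IsNeg (ρ w β)}.Finite := by
  induction w using cs.simple_induction_left with
  | one =>
    refine (Set.finite_singleton 0).subset ?_
    rintro β ⟨-, hpos, hneg⟩
    funext t
    have h₁ := hpos t
    have h₂ := hneg t
    simp only [map_one, LinearEquiv.coe_one, id_eq, Pi.neg_apply] at h₂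
    simp only [Pi.zero_apply]
    linarith
  | mul_simple_left w s ih =>
    refine (ih.insert (ρ w⁻¹ (simpleRoot s))).subset ?_
    rintro β ⟨hβ, hpos, hneg⟩
    have hwβ : IsRoot ρ (ρ w β) := by
      obtain ⟨u, t, rfl⟩ := hβ
      exact ⟨w * u, t, (rep_mul_apply w u _).symm⟩
    rw [rep_mul_apply] at hneg
    rcases isPos_or_isNeg_of_isRoot hρ hwβ with h | h
    · left
      rw [← eq_simpleRoot_of_isPos_of_isNeg hρ hwβ h hneg, ← rep_mul_apply]
      simp
    · exact Or.inr ⟨hβ, hpos, h⟩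

end Representation

omit [Fintype B] [DecidableEq B] in
/-- The `w`-orbit of a non-periodic vector is injectively parametrized by `ℤ`. -/
theorem injective_zpow_apply {ρ : W →* ((B → ℝ) ≃ₗ[ℝ] (B → ℝ))} {w : W} {α : B → ℝ}
    (h : ¬ IsPeriodic ρ w α) : Function.Injective fun m : ℤ => ρ (w ^ m) α := by
  suffices hlt : ∀ a b : ℤ, a < b → ρ (w ^ a) α ≠ ρ (w ^ b) α by
    intro a b hab
    by_contra hne
    exact (lt_or_gt_of_ne hne).elim (fun hl => hlt a b hl hab) (fun hl => hlt b a hl hab.symm)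
  refine fun a b hab heq => h ⟨(b - a).toNat, by omega, ?_⟩
  have hcast : ((b - a).toNat : ℤ) = -a + b := by omega
  rw [← zpow_natCast, hcast, zpow_add, rep_mul_apply, ← heq, ← rep_mul_apply, ← zpow_add]
  simp

theorem finite_sepSet {cs : CoxeterSystem M W} {ρ : W →* ((B → ℝ) ≃ₗ[ℝ] (B → ℝ))}
    (hρ : ∀ (s : B) (x : B → ℝ), ρ (cs.simple s) x =
      x - (2 * canonicalForm M x (simpleRoot s)) • simpleRoot s)
    {w : W} {α : B → ℝ} (hα : IsRoot ρ α) (h : ¬ IsPeriodic ρ w α) :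
    (sepSet ρ w α).Finite := by
  have hinj := injective_zpow_apply h
  have hroot : ∀ u : W, IsRoot ρ (ρ u α) := by
    obtain ⟨v, s, rfl⟩ := hα
    exact fun u => ⟨u * v, s, (rep_mul_apply u v _).symm⟩
  have hinj' : Function.Injective fun m : ℤ => ρ (w ^ (m + 1)) α :=
    hinj.comp (add_left_injective 1)
  refine (((finite_inversions hρ w).preimage hinj.injOn).union
    ((finite_inversions hρ w⁻¹).preimage hinj'.injOn)).subset ?_
  rintro m (⟨hpos, hneg⟩ | ⟨hneg, hpos⟩)
  · refine Or.inl ⟨hroot _, hpos, ?_⟩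
    rwa [← rep_mul_apply, ← zpow_one_add, add_comm]
  · refine Or.inr ⟨hroot _, hpos, ?_⟩
    rwa [← rep_mul_apply, add_comm, zpow_one_add, inv_mul_cancel_left]

/-- If `α ∈ Φ` is not `w`-periodic then `{m ∈ ℤ : α separates w^m and w^{m+1}}`
is finite; consequently exactly one of the following holds: `α` is `w`-periodic, `α` is `w`-even,
`α` is `w`-odd. -/
theorem sepSet_finite_and_trichotomy
    (cs : CoxeterSystem M W)
    (ρ : W →* ((B → ℝ) ≃ₗ[ℝ] (B → ℝ)))
    (hρ : ∀ (s : B) (x : B → ℝ), ρ (cs.simple s) x =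
      x - (2 * canonicalForm M x (simpleRoot s)) • simpleRoot s)
    (w : W) (α : B → ℝ) (hα : IsRoot ρ α) :
    (¬ IsPeriodic ρ w α → (sepSet ρ w α).Finite) ∧
    ((IsPeriodic ρ w α ∧ ¬ IsWEven ρ w α ∧ ¬ IsWOdd ρ w α) ∨
     (¬ IsPeriodic ρ w α ∧ IsWEven ρ w α ∧ ¬ IsWOdd ρ w α) ∨
     (¬ IsPeriodic ρ w α ∧ ¬ IsWEven ρ w α ∧ IsWOdd ρ w α)) := by
  have hfin := finite_sepSet hρ hα (w := w)
  refine ⟨hfin, ?_⟩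
  by_cases hper : IsPeriodic ρ w α
  · exact Or.inl ⟨hper, fun h => h.1 hper, fun h => h.1 hper⟩
  · rcases Nat.even_or_odd (sepSet ρ w α).ncard with heven | hodd
    · exact Or.inr (Or.inl ⟨hper, ⟨hper, hfin hper, heven⟩,
        fun h => Nat.not_even_iff_odd.2 h.2.2 heven⟩)
    · exact Or.inr (Or.inr ⟨hper, fun h => Nat.not_even_iff_odd.2 hodd h.2.2,
        ⟨hper, hfin hper, hodd⟩⟩)

end CoxeterPaper
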